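/- arXiv:2008.00663 — 4 statements merged into one kernel-verified Lean document; each statement's English description precedes it below -/
import Mathlib

section
/- Let m ≥ 3, q = 2^m, F = GF(q), and let f : F → F be an oval polynomial. Then the number of codewords of Hamming weight 3 in the dual code Ē_f^⊥ is exactly (q-1)(q+2)/2. -/
/-- The Hamming weight of a vector: the number of nonzero coordinates. -/
def wt {ι F : Type} [Fintype ι] [DecidableEq F] [Zero F] (v : ι → F) : ℕ :=
  (Finset.univ.filter fun i => v i ≠ 0).card

/-- The codeword of the extended code `Ē_f` of length `q+3` associated to
`(a,b,c) ∈ F³`: the vector `((a·f(x)+b·x+c)_{x ∈ F}, a, b, a+b)`. -/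
def Ebarword {F : Type} [Field F] (f : F → F) (p : F × F × F) : F ⊕ Fin 3 → F :=
  Sum.elim (fun x => p.1 * f x + p.2.1 * x + p.2.2) ![p.1, p.2.1, p.1 + p.2.1]

section OvalPolynomial

variable {F : Type} [Field F]

theorem charP_two_of_card_eq_two_pow [Fintype F] {m : ℕ} (hcard : Fintype.card F = 2 ^ m) :
    CharP F 2 :=
  haveI : Fact (Nat.Prime 2) := ⟨Nat.prime_two⟩
  charP_of_card_eq_prime_pow hcard

theorem FiniteField.pow_card_sub_two [Fintype F] (h : 2 < Fintype.card F) (x : F) :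
    x ^ (Fintype.card F - 2) = x⁻¹ := by
  rcases eq_or_ne x 0 with rfl | hx
  · rw [inv_zero, zero_pow (by omega)]
  · apply eq_inv_of_mul_eq_one_left
    rw [← pow_succ, ← FiniteField.pow_card_sub_one_eq_one x hx]
    congr 1
    omega

/-- The words orthogonal to `Ē_f` are those satisfying three parity checks. -/
theorem forall_sum_mul_Ebarword_eq_zero_iff [Fintype F] (f : F → F) (v : F ⊕ Fin 3 → F) :
    (∀ p : F × F × F, ∑ i, v i * Ebarword f p i = 0) ↔
      (∑ x, v (.inl x) * f x) + v (.inr 0) + v (.inr 2) = 0 ∧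
      (∑ x, v (.inl x) * x) + v (.inr 1) + v (.inr 2) = 0 ∧
      ∑ x, v (.inl x) = 0 := by
  constructor
  · intro h
    have h₁ := h (1, 0, 0)
    have h₂ := h (0, 1, 0)
    have h₃ := h (0, 0, 1)
    simp [Ebarword, Fin.sum_univ_three] at h₁ h₂ h₃
    exact ⟨by rw [add_assoc, h₁], by rw [add_assoc, h₂], h₃⟩
  · rintro ⟨h₁, h₂, h₃⟩ ⟨a, b, c⟩
    have key : ∑ x, v (.inl x) * (a * f x + b * x + c) =
        a * ∑ x, v (.inl x) * f x + b * ∑ x, v (.inl x) * x + c * ∑ x, v (.inl x) := by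
      simp only [Finset.mul_sum, ← Finset.sum_add_distrib]
      exact Finset.sum_congr rfl fun x _ => by ring
    simp [Ebarword, Fin.sum_univ_three, key]
    linear_combination a * h₁ + b * h₂ + c * h₃

/-- The word of weight three supported on the three extra positions. -/
def infinityWord : F ⊕ Fin 3 → F :=
  Sum.elim (fun _ => 0) (fun _ => 1)

theorem sum_mul_Ebarword_smul [Fintype F] {f : F → F} {v : F ⊕ Fin 3 → F}
    (h : ∀ p : F × F × F, ∑ i, v i * Ebarword f p i = 0) (c : F) (p : F × F × F) :
    ∑ i, (c • v) i * Ebarword f p i = 0 := by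
  simp only [Pi.smul_apply, smul_eq_mul, mul_assoc, ← Finset.mul_sum, h p, mul_zero]

theorem infinityWord_dual [Fintype F] [CharP F 2] (f : F → F) (p : F × F × F) :
    ∑ i, infinityWord i * Ebarword f p i = 0 := by
  revert p
  rw [forall_sum_mul_Ebarword_eq_zero_iff]
  simp [infinityWord, CharTwo.add_self_eq_zero]

variable [DecidableEq F]

theorem wt_sum_eq [Fintype F] (v : F ⊕ Fin 3 → F) :
    wt v = (Finset.univ.filter fun x => v (.inl x) ≠ 0).card +
      ((if v (.inr 0) ≠ 0 then 1 else 0) + (if v (.inr 1) ≠ 0 then 1 else 0) +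
        (if v (.inr 2) ≠ 0 then 1 else 0)) := by
  simp only [wt, Finset.card_filter, Fintype.sum_sum_type, Fin.sum_univ_three]

/-- The word of weight three supported on the two affine positions `a`, `b` and on the last
position. -/
def secantWord (a b : F) : F ⊕ Fin 3 → F :=
  Sum.elim (fun x => if x = a ∨ x = b then 1 else 0) ![0, 0, a + b]

theorem sum_eq_add_of_support [Fintype F] {u : F → F} {a b : F} (hab : a ≠ b)
    (hu : ∀ x, x ≠ a → x ≠ b → u x = 0) (g : F → F) :
    ∑ x, u x * g x = u a * g a + u b * g b := by
  rw [← Finset.sum_pair (f := fun x => u x * g x) hab]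
  refine (Finset.sum_subset (Finset.subset_univ _) fun x _ hx => ?_).symm
  simp only [Finset.mem_insert, Finset.mem_singleton, not_or] at hx
  rw [hu x hx.1 hx.2, zero_mul]

theorem wt_smul [Fintype F] {c : F} (hc : c ≠ 0) (v : F ⊕ Fin 3 → F) : wt (c • v) = wt v := by
  simp [wt, hc]

theorem wt_infinityWord [Fintype F] : wt (infinityWord : F ⊕ Fin 3 → F) = 3 := by
  simp [wt_sum_eq, infinityWord]

theorem wt_secantWord [Fintype F] [CharP F 2] {a b : F} (hab : a ≠ b) :
    wt (secantWord a b) = 3 := by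
  have h0 : a + b ≠ 0 := fun h => hab (CharTwo.add_eq_zero.mp h)
  have h : (Finset.univ.filter fun x : F => ¬x = a → x = b) = {a, b} := by
    ext
    simp [or_iff_not_imp_left]
  rw [wt_sum_eq]
  simp [secantWord, h, Finset.card_pair hab, h0]

theorem secantWord_dual [Fintype F] [CharP F 2] {f : F → F} {a b : F} (hab : a ≠ b)
    (hf : f a + f b = a + b) (p : F × F × F) :
    ∑ i, secantWord a b i * Ebarword f p i = 0 := by
  revert p
  have hu : ∀ x, x ≠ a → x ≠ b → secantWord a b (.inl x) = 0 := by
    intro x ha hb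
    simp [secantWord, ha, hb]
  have h₁ := sum_eq_add_of_support hab hu f
  have h₂ := sum_eq_add_of_support hab hu (fun x => x)
  have h₃ := sum_eq_add_of_support hab hu (fun _ => 1)
  simp only [mul_one] at h₃
  rw [forall_sum_mul_Ebarword_eq_zero_iff, h₁, h₂, h₃]
  simp [secantWord, hf, CharTwo.add_self_eq_zero]

/-- Classification of the dual words of weight three. -/
theorem eq_smul_infinityWord_or_eq_smul_secantWord [Fintype F] [CharP F 2] {f : F → F}
    (hf : Function.Injective f)
    (hslope : ∀ a x y : F, x ≠ 0 → y ≠ 0 →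
      (f (x + a) + f a) * y = (f (y + a) + f a) * x → x = y)
    {v : F ⊕ Fin 3 → F} (hv : ∀ p : F × F × F, ∑ i, v i * Ebarword f p i = 0) (hwt : wt v = 3) :
    (∃ c : F, c ≠ 0 ∧ v = c • infinityWord) ∨
      ∃ c : F, c ≠ 0 ∧ ∃ a b, a ≠ b ∧ f a + f b = a + b ∧ v = c • secantWord a b := by
  obtain ⟨h₁, h₂, h₃⟩ := (forall_sum_mul_Ebarword_eq_zero_iff f v).mp hv
  rw [wt_sum_eq] at hwt
  set s := Finset.univ.filter fun x => v (.inl x) ≠ 0 with hs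
  have hsupp (x : F) : x ∉ s → v (.inl x) = 0 := by simp [hs]
  have hne (x : F) : x ∈ s → v (.inl x) ≠ 0 := by simp [hs]
  have hsum (g : F → F) : ∑ x, v (.inl x) * g x = ∑ x ∈ s, v (.inl x) * g x :=
    (Finset.sum_subset (Finset.subset_univ s) fun x _ hx => by rw [hsupp x hx, zero_mul]).symm
  have hsum₁ := hsum fun _ => 1
  simp only [mul_one] at hsum₁
  rw [hsum] at h₁
  rw [hsum fun x => x] at h₂
  rw [hsum₁] at h₃
  have hle : s.card ≤ 3 := by omega
  interval_cases hcs : s.card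
  · left
    rw [Finset.card_eq_zero] at hcs
    rw [hcs] at h₁ h₂ hsupp
    simp only [Finset.sum_empty, zero_add, CharTwo.add_eq_zero] at h₁ h₂
    refine ⟨v (.inr 2), fun h => ?_, ?_⟩
    · simp [h, h₁, h₂] at hwt
    · ext (x | k)
      · simp [infinityWord, hsupp x (by simp)]
      · fin_cases k <;> simp [infinityWord, h₁, h₂]
  · obtain ⟨a, ha⟩ := Finset.card_eq_one.mp hcs
    rw [ha, Finset.sum_singleton] at h₃
    exact absurd h₃ (hne a (by simp [ha]))
  · right
    obtain ⟨a, b, hab, hsab⟩ := Finset.card_eq_two.mp hcs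
    rw [hsab, Finset.sum_pair hab] at h₁ h₂ h₃
    have hc := hne a (by simp [hsab])
    have hvb : v (.inl b) = v (.inl a) := (CharTwo.add_eq_zero.mp h₃).symm
    rw [hvb, ← mul_add, add_assoc, CharTwo.add_eq_zero] at h₁ h₂
    have hab0 : a + b ≠ 0 := fun h => hab (CharTwo.add_eq_zero.mp h)
    have hfab0 : f a + f b ≠ 0 := fun h => hab (hf (CharTwo.add_eq_zero.mp h))
    have hn₁ : v (.inr 0) + v (.inr 2) ≠ 0 := h₁ ▸ mul_ne_zero hc hfab0
    have hn₂ : v (.inr 1) + v (.inr 2) ≠ 0 := h₂ ▸ mul_ne_zero hc hab0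
    have hz : v (.inr 0) = 0 ∧ v (.inr 1) = 0 := by
      clear h₁ h₂ h₃
      split_ifs at hwt <;> grind
    rw [hz.1, zero_add] at h₁
    rw [hz.2, zero_add] at h₂
    refine ⟨v (.inl a), hc, a, b, hab, mul_left_cancel₀ hc (h₁.trans h₂.symm), ?_⟩
    ext (x | k)
    · by_cases hx : x = a ∨ x = b
      · rcases hx with rfl | rfl <;> simp [secantWord, hvb]
      · rw [hsupp x (by simpa [hsab] using hx)]
        simp [secantWord, hx]
    · fin_cases k
      · simp [secantWord, hz]
      · simp [secantWord, hz]
      · simp [secantWord, h₂]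
  · exfalso
    obtain ⟨a, b, c, hab, hac, hbc, habc⟩ := Finset.card_eq_three.mp hcs
    have hz : v (.inr 0) = 0 ∧ v (.inr 1) = 0 ∧ v (.inr 2) = 0 := by
      clear h₁ h₂ h₃
      split_ifs at hwt <;> grind
    have hthree (g : F → F) : ∑ x ∈ s, g x = g a + g b + g c := by
      rw [habc, Finset.sum_insert (by simp [hab, hac]), Finset.sum_pair hbc, add_assoc]
    rw [hthree, hz.1, hz.2.2] at h₁
    rw [hthree, hz.2.1, hz.2.2] at h₂
    rw [hthree] at h₃
    have h2 : (2 : F) = 0 := CharTwo.two_eq_zero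
    have hb0 : b + a ≠ 0 := fun h => hab (CharTwo.add_eq_zero.mp h).symm
    have hc0 : c + a ≠ 0 := fun h => hac (CharTwo.add_eq_zero.mp h).symm
    have hcancel (x : F) : x + a + a = x := by
      rw [add_assoc, CharTwo.add_self_eq_zero, add_zero]
    refine hbc (add_right_cancel (hslope a (b + a) (c + a) hb0 hc0 ?_))
    rw [hcancel, hcancel]
    apply mul_left_cancel₀ (hne b (by simp [habc]))
    have e₁ : v (.inl b) * (f b + f a) + v (.inl c) * (f c + f a) = 0 := by
      linear_combination h₁ + f a * h₃ - v (.inl a) * f a * h2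
    have e₂ : v (.inl b) * (b + a) + v (.inl c) * (c + a) = 0 := by
      linear_combination h₂ + a * h₃ - v (.inl a) * a * h2
    linear_combination (c + a) * e₁ - (f c + f a) * e₂

/-- Through every position other than the last one there is exactly one dual word of weight three,
up to scalars. -/
theorem exists_word_through [Fintype F] [CharP F 2] {f : F → F}
    (hf : Function.Injective f)
    (hslope : ∀ a x y : F, x ≠ 0 → y ≠ 0 →
      (f (x + a) + f a) * y = (f (y + a) + f a) * x → x = y)
    (hex : ∀ a, ∃ x ≠ 0, f (x + a) + f a = x)
    {i : F ⊕ Fin 3} (hi : i ≠ .inr 2) :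
    ∃ w : F ⊕ Fin 3 → F, w i = 1 ∧ (∀ p : F × F × F, ∑ j, w j * Ebarword f p j = 0) ∧ wt w = 3 ∧
      ∀ v : F ⊕ Fin 3 → F, (∀ p : F × F × F, ∑ j, v j * Ebarword f p j = 0) → wt v = 3 →
        v i ≠ 0 → ∃ c : F, v = c • w := by
  rcases i with a | k
  · obtain ⟨x, hx, hfx⟩ := hex a
    have hne : a ≠ x + a := by simpa using hx
    have hsec : f a + f (x + a) = a + (x + a) := by
      rw [add_comm, hfx, add_left_comm, CharTwo.add_self_eq_zero, add_zero]
    have huniq (b : F) (hab : a ≠ b) (hfb : f a + f b = a + b) : b = x + a := by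
      have hbaa : b + a + a = b := by rw [add_assoc, CharTwo.add_self_eq_zero, add_zero]
      have hb0 : b + a ≠ 0 := fun h => hab (CharTwo.add_eq_zero.mp h).symm
      rw [← hslope a (b + a) x hb0 hx (by rw [hbaa, hfx, add_comm (f b), hfb]; ring), hbaa]
    refine ⟨secantWord a (x + a), by simp [secantWord], secantWord_dual hne hsec,
      wt_secantWord hne, fun v hv hwt hva => ?_⟩
    rcases eq_smul_infinityWord_or_eq_smul_secantWord hf hslope hv hwt with
      ⟨c, -, rfl⟩ | ⟨c, -, b, d, hbd, hfbd, rfl⟩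
    · simp [infinityWord] at hva
    · have had : a = b ∨ a = d := by
        by_contra h
        simp [secantWord, h] at hva
      refine ⟨c, ?_⟩
      rcases had with rfl | rfl
      · rw [huniq d hbd hfbd]
      · rw [huniq b hbd.symm (by rw [add_comm, hfbd, add_comm])]
        congr 1
        simp only [secantWord, or_comm, add_comm]
  · refine ⟨infinityWord, rfl, infinityWord_dual f, wt_infinityWord, fun v hv hwt hva => ?_⟩
    rcases eq_smul_infinityWord_or_eq_smul_secantWord hf hslope hv hwt with
      ⟨c, -, rfl⟩ | ⟨c, -, b, d, hbd, hfbd, rfl⟩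
    · exact ⟨c, rfl⟩
    · fin_cases k <;> simp [secantWord] at hva hi

end OvalPolynomial

/-- **Theorem.**  Let `m ≥ 3`, `q = 2^m`, `F = GF(q)` and let `f` be an oval
polynomial over `F`.  Then the number of codewords of Hamming weight `3` in
the dual code `Ē_f^⊥` is exactly `(q-1)(q+2)/2`. -/
theorem stmt_6 (m : ℕ) (hm : 3 ≤ m)
    (F : Type) [Field F] [Fintype F] [DecidableEq F] (hcard : Fintype.card F = 2 ^ m)
    (f : F → F)
    (hbij : Function.Bijective f) (hf0 : f 0 = 0) (hf1 : f 1 = 1)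
    (hoval : ∀ a : F, Function.Bijective fun x : F => (f (x + a) + f a) * x ^ (2 ^ m - 2)) :
    2 * Nat.card {v : F ⊕ Fin 3 → F //
        (∀ p : F × F × F, ∑ i, v i * Ebarword f p i = 0) ∧ wt v = 3}
      = (2 ^ m - 1) * (2 ^ m + 2) := by
  have hchar : CharP F 2 := charP_two_of_card_eq_two_pow hcard
  have h8 : 2 ^ 3 ≤ 2 ^ m := Nat.pow_le_pow_right (by norm_num) hm
  have hinv (x : F) : x ^ (2 ^ m - 2) = x⁻¹ := by
    rw [← hcard]
    exact FiniteField.pow_card_sub_two (by omega) x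
  simp only [hinv] at hoval
  have hslope (a x y : F) (hx : x ≠ 0) (hy : y ≠ 0)
      (h : (f (x + a) + f a) * y = (f (y + a) + f a) * x) : x = y := by
    apply (hoval a).injective
    simp only
    rwa [← div_eq_mul_inv, ← div_eq_mul_inv, div_eq_div_iff hx hy]
  have hex (a : F) : ∃ x ≠ 0, f (x + a) + f a = x := by
    obtain ⟨x, hx⟩ := (hoval a).surjective 1
    simp only at hx
    have hx0 : x ≠ 0 := by
      rintro rfl
      simp at hx
    exact ⟨x, hx0, by rwa [mul_inv_eq_one₀ hx0] at hx⟩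
  classical
  set W : Finset (F ⊕ Fin 3 → F) := Finset.univ.filter fun v =>
    (∀ p : F × F × F, ∑ i, v i * Ebarword f p i = 0) ∧ wt v = 3 with hW
  have hcardW : Nat.card {v : F ⊕ Fin 3 → F //
      (∀ p : F × F × F, ∑ i, v i * Ebarword f p i = 0) ∧ wt v = 3} = W.card := by
    rw [Nat.card_eq_fintype_card, Fintype.card_subtype]
  rw [hcardW]
  have habove : ∀ v ∈ W, (Finset.bipartiteAbove (fun v i => v i ≠ 0)
      (Finset.univ.erase (Sum.inr 2)) v).card = 2 := by
    intro v hv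
    obtain ⟨hv, hwt⟩ := (Finset.mem_filter.mp hv).2
    have hlast : v (.inr 2) ≠ 0 := by
      rcases eq_smul_infinityWord_or_eq_smul_secantWord hbij.injective hslope hv hwt with
        ⟨c, hc, rfl⟩ | ⟨c, hc, a, b, hab, -, rfl⟩
      · simpa [infinityWord] using hc
      · simpa [secantWord, hc, CharTwo.add_eq_zero] using hab
    rw [Finset.bipartiteAbove, Finset.filter_erase, Finset.card_erase_of_mem (by simpa using hlast)]
    rw [wt] at hwt
    rw [hwt]
  have hbelow : ∀ i ∈ Finset.univ.erase (Sum.inr 2), (Finset.bipartiteBelow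
      (fun (v : F ⊕ Fin 3 → F) i => v i ≠ 0) W i).card = 2 ^ m - 1 := by
    intro i hi
    obtain ⟨w, hwi, hw, hwt, huniq⟩ :=
      exists_word_through hbij.injective hslope hex (Finset.ne_of_mem_erase hi)
    have himage : Finset.bipartiteBelow (fun (v : F ⊕ Fin 3 → F) i => v i ≠ 0) W i =
        (Finset.univ.erase (0 : F)).image (· • w) := by
      ext v
      simp only [Finset.mem_bipartiteBelow, hW, Finset.mem_filter, Finset.mem_univ, true_and,
        Finset.mem_image, Finset.mem_erase, and_true]
      constructor
      · rintro ⟨⟨hv, hvt⟩, hvi⟩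
        obtain ⟨c, rfl⟩ := huniq v hv hvt hvi
        exact ⟨c, fun hc => hvi (by simp [hc]), rfl⟩
      · rintro ⟨c, hc, rfl⟩
        exact ⟨⟨sum_mul_Ebarword_smul hw c, (wt_smul hc w).trans hwt⟩, by simpa [hwi] using hc⟩
    rw [himage, Finset.card_image_of_injective, Finset.card_erase_of_mem (Finset.mem_univ _),
      Finset.card_univ, hcard]
    intro c d hcd
    simpa [hwi] using congrFun hcd i
  have hcount := Finset.card_mul_eq_card_mul _ habove hbelow
  rw [mul_comm, hcount, Finset.card_erase_of_mem (Finset.mem_univ _), Finset.card_univ,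
    Fintype.card_sum, hcard, Fintype.card_fin, mul_comm]
  rfl
end

section
/- Let m ≥ 3, q = 2^m, F = GF(q), and let f : F → F be an oval polynomial. Then every nonzero codeword of Ē_f has Hamming weight q, q+1, q+2, or q+3, and the numbers of codewords of these weights are: (q-1)(q+2)/2 of weight q, (q-1)·q·(q+2)/2 of weight q+1, (q-1)·q/2 of weight q+2, and (q-2)(q-1)·q/2 of weight q+3. -/
/-- The number of `x` with `a·f(x) + b·x + c = 0`. -/
def zeroCount {F : Type} [Field F] [Fintype F] [DecidableEq F] (f : F → F) (a b c : F) : ℕ :=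
  (Finset.univ.filter fun x => a * f x + b * x + c = 0).card

/-- The number of `c` for which the codeword of `(a,b,c)` has weight `w`. -/
def weightCount {F : Type} [Field F] [Fintype F] [DecidableEq F] (f : F → F) (w : ℕ)
    (a b : F) : ℕ :=
  (Finset.univ.filter fun c => wt (Ebarword f (a, b, c)) = w).card

section

variable {F : Type} [Field F] {f : F → F}

theorem Ebarword_injective : Function.Injective (Ebarword f) := by
  rintro ⟨a, b, c⟩ ⟨a', b', c'⟩ h
  have h0 : a = a' := by simpa [Ebarword] using congrFun h (Sum.inr 0)
  have h1 : b = b' := by simpa [Ebarword] using congrFun h (Sum.inr 1)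
  have h2 := congrFun h (Sum.inl 0)
  subst h0 h1
  have h3 : c = c' := by simpa [Ebarword] using h2
  rw [h3]

theorem bijective_zero_left {b : F} (hb : b ≠ 0) :
    Function.Bijective fun x => 0 * f x + b * x := by
  simpa using mulLeft_bijective₀ b hb

theorem bijective_zero_right (hf : Function.Bijective f) {a : F} (ha : a ≠ 0) :
    Function.Bijective fun x => a * f x + 0 * x := by
  simpa [Function.comp_def] using (mulLeft_bijective₀ a ha).comp hf

variable [Fintype F] [DecidableEq F]

theorem wt_Ebarword_add [CharP F 2] (a b c : F) :
    wt (Ebarword f (a, b, c)) + (zeroCount f a b c + (if a = 0 then 1 else 0)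
      + (if b = 0 then 1 else 0) + (if a = b then 1 else 0)) = Fintype.card F + 3 := by
  have h := Finset.card_filter_add_card_filter_not (s := (Finset.univ : Finset F))
    (fun x => a * f x + b * x + c = 0)
  have hw : wt (Ebarword f (a, b, c)) =
      (Finset.univ.filter fun x => ¬ (a * f x + b * x + c = 0)).card
        + ((if a = 0 then 0 else 1) + (if b = 0 then 0 else 1) + (if a = b then 0 else 1)) := by
    rw [wt, Finset.card_filter, Finset.card_filter, Fintype.sum_sum_type, Fin.sum_univ_three]
    simp [Ebarword, CharTwo.add_eq_zero]
    by_cases ha : a = 0 <;> by_cases hb : b = 0 <;> simp [ha, hb]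
  rw [hw, zeroCount]
  rw [Finset.card_univ] at h
  split_ifs <;> omega

theorem card_codewords_eq_sum (w : ℕ) :
    Nat.card {v : F ⊕ Fin 3 → F // (∃ p : F × F × F, v = Ebarword f p) ∧ wt v = w}
      = ∑ a, ∑ b, weightCount f w a b := by
  have e : {p : F × F × F // wt (Ebarword f p) = w} ≃
      {v : F ⊕ Fin 3 → F // (∃ p : F × F × F, v = Ebarword f p) ∧ wt v = w} :=
    Equiv.ofBijective (fun p => ⟨Ebarword f p.1, ⟨p.1, rfl⟩, p.2⟩) (by
      constructor
      · intro p p' h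
        exact Subtype.ext (Ebarword_injective (congrArg Subtype.val h))
      · rintro ⟨v, ⟨p, rfl⟩, hw⟩
        exact ⟨⟨p, hw⟩, rfl⟩)
  rw [← Nat.card_congr e, Nat.card_eq_fintype_card, Fintype.card_subtype]
  simp only [weightCount, Finset.card_filter, Fintype.sum_prod_type]

theorem sum_zeroCount (a b : F) : ∑ c, zeroCount f a b c = Fintype.card F := by
  simp only [zeroCount, Finset.card_filter]
  rw [Finset.sum_comm]
  simp [add_eq_zero_iff_eq_neg']

theorem zeroCount_zero_zero (c : F) :
    zeroCount f 0 0 c = if c = 0 then Fintype.card F else 0 := by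
  by_cases h : c = 0 <;> simp [zeroCount, h]

theorem zeroCount_eq_one {a b : F} (h : Function.Bijective fun x => a * f x + b * x) (c : F) :
    zeroCount f a b c = 1 := by
  obtain ⟨x, hx, hu⟩ := h.existsUnique (-c)
  refine Finset.card_eq_one.2 ⟨x, ?_⟩
  ext y
  simp only [Finset.mem_filter, Finset.mem_univ, true_and, Finset.mem_singleton,
    add_eq_zero_iff_eq_neg]
  exact ⟨hu y, fun h => h ▸ hx⟩

theorem zeroCount_eq_zero_or_two [CharP F 2]
    (hslope : ∀ s x : F, s ≠ 0 → ∃! t, t ≠ 0 ∧ f (t + x) + f x = s * t)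
    {a b : F} (ha : a ≠ 0) (hb : b ≠ 0) (c : F) :
    zeroCount f a b c = 0 ∨ zeroCount f a b c = 2 := by
  rcases Finset.eq_empty_or_nonempty
    (Finset.univ.filter fun x => a * f x + b * x + c = 0) with h | ⟨x, hx⟩
  · exact Or.inl (Finset.card_eq_zero.2 h)
  · right
    have hx : a * f x + b * x + c = 0 := by simpa using hx
    obtain ⟨t, ⟨ht, hts⟩, hu⟩ := hslope (b / a) x (div_ne_zero hb ha)
    have key : ∀ u : F, a * f (u + x) + b * (u + x) + c = 0 ↔ f (u + x) + f x = b / a * u := by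
      intro u
      have h2 : (2 : F) = 0 := CharTwo.two_eq_zero
      rw [div_mul_eq_mul_div, eq_div_iff ha]
      constructor <;> intro h
      · linear_combination h + hx - (b * u + b * x + c) * h2
      · linear_combination h - hx + (b * x + b * u + c) * h2
    refine Finset.card_eq_two.2 ⟨x, t + x, by simpa using ht, ?_⟩
    ext y
    simp only [Finset.mem_filter, Finset.mem_univ, true_and, Finset.mem_insert,
      Finset.mem_singleton]
    constructor
    · intro hy
      by_cases hyx : y = x
      · exact Or.inl hyx
      · right
        have := hu (y - x) ⟨sub_ne_zero.2 hyx, (key _).1 (by simpa using hy)⟩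
        rw [← this, sub_add_cancel]
    · rintro (rfl | rfl)
      · exact hx
      · exact (key t).2 hts

theorem two_mul_card_zeroCount_eq {a b : F}
    (h : ∀ c, zeroCount f a b c = 0 ∨ zeroCount f a b c = 2) :
    2 * (Finset.univ.filter fun c => zeroCount f a b c = 2).card = Fintype.card F ∧
    2 * (Finset.univ.filter fun c => zeroCount f a b c = 0).card = Fintype.card F := by
  have h2 : 2 * (Finset.univ.filter fun c => zeroCount f a b c = 2).card = Fintype.card F := by
    rw [← sum_zeroCount (f := f) a b, Finset.card_filter, Finset.mul_sum]
    refine Finset.sum_congr rfl fun c _ => ?_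
    rcases h c with h | h <;> simp [h]
  refine ⟨h2, ?_⟩
  have hs := Finset.card_filter_add_card_filter_not (s := (Finset.univ : Finset F))
    (fun c => zeroCount f a b c = 2)
  have hn : (Finset.univ.filter fun c => ¬ zeroCount f a b c = 2)
      = Finset.univ.filter fun c => zeroCount f a b c = 0 := by
    refine Finset.filter_congr fun c _ => ?_
    have := h c
    omega
  rw [hn, Finset.card_univ] at hs
  omega

/-- A function of pairs that is constant on the classes `{(0,0)}`, exactly one entry zero,
`a = b ≠ 0`, and the rest. -/
def pairClass (A B C D : ℕ) (a b : F) : ℕ :=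
  if a = 0 then (if b = 0 then A else B) else if b = 0 then B else if a = b then C else D

theorem sum_pairClass (A B C D : ℕ) :
    ∑ a : F, ∑ b : F, pairClass A B C D a b =
      A + 2 * (Fintype.card F - 1) * B + (Fintype.card F - 1) * C
        + (Fintype.card F - 1) * (Fintype.card F - 2) * D := by
  have hsplit (g : F → ℕ) (a : F) : ∑ b, g b = g a + ∑ b ∈ Finset.univ.erase a, g b :=
    (Finset.add_sum_erase _ _ (Finset.mem_univ a)).symm
  have h0 : ∑ b : F, pairClass A B C D 0 b = A + (Fintype.card F - 1) * B := by
    rw [hsplit _ 0, Finset.sum_congr rfl (g := fun _ => B)]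
    · simp [pairClass, Finset.card_erase_of_mem]
    · intro b hb
      simp [pairClass, Finset.ne_of_mem_erase hb]
  have h1 : ∀ a ∈ Finset.univ.erase (0 : F),
      ∑ b : F, pairClass A B C D a b = B + C + (Fintype.card F - 2) * D := by
    intro a ha
    have ha := Finset.ne_of_mem_erase ha
    have hmem : a ∈ Finset.univ.erase (0 : F) := by simp [ha]
    rw [hsplit _ 0, ← Finset.add_sum_erase _ _ hmem, Finset.sum_congr rfl (g := fun _ => D)]
    · simp [pairClass, ha, Finset.card_erase_of_mem, Nat.sub_sub, add_assoc]
    · intro b hb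
      simp only [Finset.mem_erase, Finset.mem_univ, and_true] at hb
      simp [pairClass, ha, hb.2, Ne.symm hb.1]
  rw [hsplit _ 0, h0, Finset.sum_congr rfl h1]
  simp only [Finset.sum_const, Finset.card_erase_of_mem (Finset.mem_univ _), Finset.card_univ,
    smul_eq_mul]
  ring

theorem two_mul_weightCount [CharP F 2] (hf : Function.Bijective f)
    (hslope : ∀ s x : F, s ≠ 0 → ∃! t, t ≠ 0 ∧ f (t + x) + f x = s * t)
    {k : ℕ} (hk : k ≤ 3) (a b : F) :
    2 * weightCount f (Fintype.card F + k) a b =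
      pairClass (if k = 0 then 2 * (Fintype.card F - 1) else 0)
        (if k = 1 then 2 * Fintype.card F else 0)
        (if k = 0 ∨ k = 2 then Fintype.card F else 0)
        (if k = 1 ∨ k = 3 then Fintype.card F else 0) a b := by
  have hq : 0 < Fintype.card F := Fintype.card_pos
  have hcount (P : F → Prop) [DecidablePred P]
      (h : ∀ c, wt (Ebarword f (a, b, c)) = Fintype.card F + k ↔ P c) :
      weightCount f (Fintype.card F + k) a b = (Finset.univ.filter P).card := by
    rw [weightCount]
    exact congrArg _ (Finset.filter_congr fun c _ => h c)
  have hwt := fun c => wt_Ebarword_add (f := f) a b c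
  by_cases ha : a = 0
  · subst ha
    by_cases hb : b = 0
    · subst hb
      rw [hcount (fun c => k = 0 ∧ c ≠ 0)]
      · by_cases hk0 : k = 0
        · simp [pairClass, hk0, Finset.filter_ne', Finset.card_erase_of_mem]
        · simp [pairClass, hk0]
      · intro c
        have := hwt c
        rw [zeroCount_zero_zero] at this
        by_cases hc : c = 0 <;> simp [hc] at this ⊢ <;> omega
    · rw [hcount (fun _ => k = 1)]
      · by_cases hk1 : k = 1 <;> simp [pairClass, hk1, hb]
      · intro c
        have := hwt c
        rw [zeroCount_eq_one (bijective_zero_left hb)] at this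
        simp [hb, Ne.symm hb] at this
        omega
  · by_cases hb : b = 0
    · subst hb
      rw [hcount (fun _ => k = 1)]
      · by_cases hk1 : k = 1 <;> simp [pairClass, hk1, ha]
      · intro c
        have := hwt c
        rw [zeroCount_eq_one (bijective_zero_right hf ha)] at this
        simp [ha] at this
        omega
    · have hz := zeroCount_eq_zero_or_two hslope ha hb
      obtain ⟨hz2, hz0⟩ := two_mul_card_zeroCount_eq hz
      have hcases : weightCount f (Fintype.card F + k) a b =
          (Finset.univ.filter fun c =>
            zeroCount f a b c + k + (if a = b then 1 else 0) = 3).card := by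
        refine hcount _ fun c => ?_
        have := hwt c
        simp only [ha, hb, if_false] at this
        omega
      have h2 (n : ℕ) (hn : n = 1) : 2 * (Finset.univ.filter fun c =>
          zeroCount f a b c + n = 3).card = Fintype.card F := by
        subst hn
        simpa using hz2
      have h0 (n : ℕ) (hn : n = 3) : 2 * (Finset.univ.filter fun c =>
          zeroCount f a b c + n = 3).card = Fintype.card F := by
        subst hn
        simpa using hz0
      have hnone (n : ℕ) (h1 : n ≠ 1) (h3 : n ≠ 3) : 2 * (Finset.univ.filter fun c =>
          zeroCount f a b c + n = 3).card = 0 := by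
        simp only [mul_eq_zero, OfNat.ofNat_ne_zero, false_or, Finset.card_eq_zero,
          Finset.filter_eq_empty_iff, Finset.mem_univ, true_imp_iff]
        intro c
        have := hz c
        omega
      have hclass : ∀ n,
          2 * (Finset.univ.filter fun c => zeroCount f a b c + n = 3).card =
            if n = 1 ∨ n = 3 then Fintype.card F else 0 := by
        intro n
        by_cases h1 : n = 1
        · rw [h2 n h1, if_pos (Or.inl h1)]
        · by_cases h3 : n = 3
          · rw [h0 n h3, if_pos (Or.inr h3)]
          · rw [hnone n h1 h3, if_neg (by tauto)]
      rw [hcases]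
      simp only [add_assoc]
      rw [hclass]
      by_cases hab : a = b
      · have hiff : k + 1 = 1 ∨ k + 1 = 3 ↔ k = 0 ∨ k = 2 := by omega
        simp only [pairClass, hb, hab, if_true, if_false, hiff]
      · simp only [pairClass, ha, hb, hab, if_false, add_zero]

theorem wt_Ebarword_of_ne_zero [CharP F 2] (hf : Function.Bijective f)
    (hslope : ∀ s x : F, s ≠ 0 → ∃! t, t ≠ 0 ∧ f (t + x) + f x = s * t)
    (p : F × F × F) (hp : Ebarword f p ≠ 0) :
    wt (Ebarword f p) = Fintype.card F ∨ wt (Ebarword f p) = Fintype.card F + 1 ∨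
      wt (Ebarword f p) = Fintype.card F + 2 ∨ wt (Ebarword f p) = Fintype.card F + 3 := by
  obtain ⟨a, b, c⟩ := p
  have h := wt_Ebarword_add (f := f) a b c
  by_cases ha : a = 0 <;> by_cases hb : b = 0
  · subst ha hb
    have hc : c ≠ 0 := by
      rintro rfl
      refine hp (funext fun i => ?_)
      rcases i with i | i
      · simp [Ebarword]
      · fin_cases i <;> simp [Ebarword]
    simp [zeroCount_zero_zero, hc] at h
    omega
  · subst ha
    simp [zeroCount_eq_one (bijective_zero_left hb), hb, Ne.symm hb] at h
    omega
  · subst hb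
    simp [zeroCount_eq_one (bijective_zero_right hf ha), ha] at h
    omega
  · have hz := zeroCount_eq_zero_or_two hslope ha hb c
    simp only [ha, hb, if_false] at h
    split_ifs at h <;> omega

theorem existsUnique_slope
    (hoval : ∀ a : F, Function.Bijective
      fun x : F => (f (x + a) + f a) * x ^ (Fintype.card F - 2))
    (hq : 2 < Fintype.card F) (s x : F) (hs : s ≠ 0) :
    ∃! t, t ≠ 0 ∧ f (t + x) + f x = s * t := by
  have key (t : F) : (t ≠ 0 ∧ f (t + x) + f x = s * t) ↔
      (f (t + x) + f x) * t ^ (Fintype.card F - 2) = s := by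
    by_cases ht : t = 0
    · have : Fintype.card F - 2 ≠ 0 := by omega
      simp [ht, this, hs.symm]
    · have hinv : t ^ (Fintype.card F - 2) = t⁻¹ := by
        refine eq_inv_of_mul_eq_one_left ?_
        rw [← pow_succ, ← FiniteField.pow_card_sub_one_eq_one t ht]
        congr 1
        omega
      rw [hinv, ← div_eq_mul_inv, div_eq_iff ht]
      simp [ht]
  simpa only [key] using (hoval x).existsUnique s

end

/-- **Theorem (weight distribution of `Ē_f`).**  Let `m ≥ 3`, `q = 2^m`,
`F = GF(q)` and let `f` be an oval polynomial over `F`.  Then every nonzero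
codeword of `Ē_f` has Hamming weight `q`, `q+1`, `q+2` or `q+3`, and the
numbers of codewords of those weights are `(q-1)(q+2)/2`, `(q-1)q(q+2)/2`,
`(q-1)q/2` and `(q-2)(q-1)q/2` respectively. -/
theorem stmt_7 (m : ℕ) (hm : 3 ≤ m)
    (F : Type) [Field F] [Fintype F] [DecidableEq F] (hcard : Fintype.card F = 2 ^ m)
    (f : F → F)
    (hbij : Function.Bijective f) (hf0 : f 0 = 0) (hf1 : f 1 = 1)
    (hoval : ∀ a : F, Function.Bijective fun x : F => (f (x + a) + f a) * x ^ (2 ^ m - 2)) :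
    (∀ v : F ⊕ Fin 3 → F, (∃ p : F × F × F, v = Ebarword f p) → v ≠ 0 →
        wt v = 2 ^ m ∨ wt v = 2 ^ m + 1 ∨ wt v = 2 ^ m + 2 ∨ wt v = 2 ^ m + 3)
    ∧ 2 * Nat.card {v : F ⊕ Fin 3 → F //
          (∃ p : F × F × F, v = Ebarword f p) ∧ wt v = 2 ^ m}
        = (2 ^ m - 1) * (2 ^ m + 2)
    ∧ 2 * Nat.card {v : F ⊕ Fin 3 → F //
          (∃ p : F × F × F, v = Ebarword f p) ∧ wt v = 2 ^ m + 1}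
        = (2 ^ m - 1) * 2 ^ m * (2 ^ m + 2)
    ∧ 2 * Nat.card {v : F ⊕ Fin 3 → F //
          (∃ p : F × F × F, v = Ebarword f p) ∧ wt v = 2 ^ m + 2}
        = (2 ^ m - 1) * 2 ^ m
    ∧ 2 * Nat.card {v : F ⊕ Fin 3 → F //
          (∃ p : F × F × F, v = Ebarword f p) ∧ wt v = 2 ^ m + 3}
        = (2 ^ m - 2) * (2 ^ m - 1) * 2 ^ m := by
  have : CharP F 2 := charP_of_card_eq_prime_pow hcard
  have hq : 2 < Fintype.card F := by
    rw [hcard]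
    calc 2 < 2 ^ 3 := by norm_num
      _ ≤ 2 ^ m := Nat.pow_le_pow_right (by norm_num) hm
  simp only [← hcard] at hoval ⊢
  have hslope := existsUnique_slope hoval hq
  have hmain {k : ℕ} (hk : k ≤ 3) := by
    have h := sum_pairClass (F := F) (if k = 0 then 2 * (Fintype.card F - 1) else 0)
        (if k = 1 then 2 * Fintype.card F else 0)
        (if k = 0 ∨ k = 2 then Fintype.card F else 0)
        (if k = 1 ∨ k = 3 then Fintype.card F else 0)
    simp only [← two_mul_weightCount hbij hslope hk, ← Finset.mul_sum,
      ← card_codewords_eq_sum] at h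
    exact h
  obtain ⟨r, hr⟩ : ∃ r, Fintype.card F = r + 2 := ⟨Fintype.card F - 2, by omega⟩
  have hr1 : Fintype.card F - 1 = r + 1 := by omega
  have hr2 : Fintype.card F - 2 = r := by omega
  refine ⟨?_, ?_, ?_, ?_, ?_⟩
  · rintro v ⟨p, rfl⟩ hv
    exact wt_Ebarword_of_ne_zero hbij hslope p hv
  · have h := hmain (k := 0) (by norm_num)
    simp only [add_zero] at h
    rw [h, hr1, hr2, hr]
    norm_num
    ring
  · rw [hmain (k := 1) (by norm_num), hr1, hr2, hr]
    norm_num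
    ring
  · rw [hmain (k := 2) (by norm_num), hr1, hr2, hr]
    norm_num
  · rw [hmain (k := 3) (by norm_num), hr1, hr2, hr]
    norm_num
    ring
end

section
/- Let m ≥ 3 be odd, q = 2^m, F = GF(q), and let f : F → F be an oval polynomial such that f(x^2) = f(x)^2 for all x ∈ F. Then C_f is a near MDS code with parameters [q+1, 3, q-2]: the minimum Hamming weight of a nonzero codeword of C_f is q-2, and the minimum Hamming weight of a nonzero codeword of the dual code C_f^⊥ is 3. -/
/-- The codeword of the code `C_f` of length `q+1` associated to `(a,b,c) ∈ F³`:
the vector `((a·f(x)+b·x+c)_{x ∈ F, x ≠ 0}, b+c, a+c)`. -/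
def Cword {F : Type} [Field F] (f : F → F) (p : F × F × F) :
    {x : F // x ≠ 0} ⊕ Fin 2 → F :=
  Sum.elim (fun x => p.1 * f x.1 + p.2.1 * x.1 + p.2.2) ![p.2.1 + p.2.2, p.1 + p.2.2]

/-- The affine points whose homogeneous coordinates are the columns of the generator matrix. -/
def columnPoint {F : Type} [Field F] (f : F → F) : {x : F // x ≠ 0} ⊕ Fin 2 → F × F :=
  Sum.elim (fun x => (f x.1, x.1)) ![(0, 1), (1, 0)]

theorem wt_add_card_zeros {ι F : Type} [Fintype ι] [DecidableEq F] [Zero F] (v : ι → F) :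
    wt v + (Finset.univ.filter fun i => v i = 0).card = Fintype.card ι := by
  rw [add_comm]
  exact Finset.card_filter_add_card_filter_not (s := Finset.univ) fun i => v i = 0

theorem pow_card_sub_two_mul_self {F : Type} [Field F] [Fintype F]
    (hq : 2 ≤ Fintype.card F) {x : F} (hx : x ≠ 0) :
    x ^ (Fintype.card F - 2) * x = 1 := by
  rw [← pow_succ, ← FiniteField.pow_card_sub_one_eq_one x hx]
  congr 1
  omega

section

variable {F : Type} [Field F] {f : F → F}

theorem Cword_apply (f : F → F) (p : F × F × F) (i : {x : F // x ≠ 0} ⊕ Fin 2) :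
    Cword f p i = p.1 * (columnPoint f i).1 + p.2.1 * (columnPoint f i).2 + p.2.2 := by
  rcases i with x | i
  · rfl
  · fin_cases i <;> simp [Cword, columnPoint]

theorem columnPoint_injective (hf1 : f 1 = 1) : Function.Injective (columnPoint f) := by
  have h01 : ∀ x : {x : F // x ≠ 0}, (f x.1, x.1) ≠ ((0, 1) : F × F) := by
    rintro ⟨x, hx⟩ h
    obtain ⟨h1, rfl⟩ := Prod.mk.inj h
    simp [hf1] at h1
  have h10 : ∀ x : {x : F // x ≠ 0}, (f x.1, x.1) ≠ ((1, 0) : F × F) :=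
    fun x h => x.2 (Prod.mk.inj h).2
  rintro (x | i) (y | j) h
  · exact congrArg _ (Subtype.ext (Prod.mk.inj h).2)
  · fin_cases j
    · exact (h01 x h).elim
    · exact (h10 x h).elim
  · fin_cases i
    · exact (h01 y h.symm).elim
    · exact (h10 y h.symm).elim
  · fin_cases i <;> fin_cases j <;> simp [columnPoint] at h ⊢

variable [Fintype F] [DecidableEq F]

theorem card_codeIndex : Fintype.card ({x : F // x ≠ 0} ⊕ Fin 2) = Fintype.card F + 1 := by
  have h : 0 < Fintype.card F := Fintype.card_pos
  rw [Fintype.card_sum, Fintype.card_subtype_compl, Fintype.card_subtype_eq, Fintype.card_fin]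
  omega

/-- A nonzero dual codeword has at least three nonzero coordinates, because the columns of the
generator matrix are pairwise distinct affine points. -/
theorem three_le_wt_of_dual (hf1 : f 1 = 1) {v : {x : F // x ≠ 0} ⊕ Fin 2 → F}
    (hv : ∀ p : F × F × F, ∑ i, v i * Cword f p i = 0) (hv0 : v ≠ 0) : 3 ≤ wt v := by
  by_contra! hlt
  obtain ⟨i, hi⟩ := Function.ne_iff.mp hv0
  have hsupp : ∀ j k, v j ≠ 0 → v k ≠ 0 → j ≠ i → k ≠ i → j = k := by
    intro j k hj hk hji hki
    by_contra hjk
    have : ({i, j, k} : Finset _).card ≤ wt v := Finset.card_le_card (by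
      intro l hl
      simp only [Finset.mem_insert, Finset.mem_singleton] at hl
      rcases hl with rfl | rfl | rfl <;> simpa)
    rw [Finset.card_eq_three.mpr ⟨i, j, k, hji.symm, hki.symm, hjk, rfl⟩] at this
    omega
  obtain ⟨j, hji, hj⟩ : ∃ j, j ≠ i ∧ ∀ k, k ≠ i → k ≠ j → v k = 0 := by
    by_cases h : ∃ j, j ≠ i ∧ v j ≠ 0
    · obtain ⟨j, hji, hj⟩ := h
      refine ⟨j, hji, fun k hki hkj => ?_⟩
      by_contra hk
      exact hkj (hsupp k j hk hj hki hji)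
    · push Not at h
      have : Nontrivial ({x : F // x ≠ 0} ⊕ Fin 2) :=
        ⟨.inr 0, .inr 1, by simp⟩
      obtain ⟨j, hj⟩ := exists_ne i
      exact ⟨j, hj, fun k hk _ => h k hk⟩
  have hsum : ∀ p, v i * Cword f p i + v j * Cword f p j = 0 := by
    intro p
    rw [← hv p, Fintype.sum_eq_add i j hji.symm]
    rintro k ⟨hki, hkj⟩
    rw [hj k hki hkj, zero_mul]
  have h1 := hsum (0, 0, 1)
  have hx := hsum (1, 0, 0)
  have hy := hsum (0, 1, 0)
  simp only [Cword_apply, zero_mul, one_mul, mul_one, zero_add, add_zero] at h1 hx hy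
  apply hji.symm
  apply columnPoint_injective hf1
  have hi' : v i ≠ 0 := hi
  ext
  · refine mul_left_cancel₀ hi' ?_
    linear_combination hx - (columnPoint f j).1 * h1
  · refine mul_left_cancel₀ hi' ?_
    linear_combination hy - (columnPoint f j).2 * h1

end

section

variable {F : Type} [Field F] {f : F → F} [Fintype F] [CharP F 2]

/-- A line meets the graph of an oval polynomial in at most one further point. -/
theorem secant_unique (hq : 2 ≤ Fintype.card F)
    (hoval : ∀ a : F, Function.Bijective
      fun x : F => (f (x + a) + f a) * x ^ (Fintype.card F - 2))
    {b x y z : F} (hy : y ≠ x) (hz : z ≠ x)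
    (hby : f y + f x = b * (y + x)) (hbz : f z + f x = b * (z + x)) : y = z := by
  have key : ∀ w, w ≠ x → f w + f x = b * (w + x) →
      (f (w + x + x) + f x) * (w + x) ^ (Fintype.card F - 2) = b := by
    intro w hw hbw
    have hwx : w + x ≠ 0 := fun h => hw (CharTwo.add_eq_zero.mp h)
    rw [add_assoc, CharTwo.add_self_eq_zero, add_zero, hbw]
    linear_combination b * pow_card_sub_two_mul_self hq hwx
  exact add_right_cancel ((hoval x).1 ((key y hy hby).trans (key z hz hbz).symm))

/-- A non-horizontal, non-vertical line through a point of the graph of an oval polynomial is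
a secant. -/
theorem exists_secant (hq : 2 < Fintype.card F)
    (hoval : ∀ a : F, Function.Bijective
      fun x : F => (f (x + a) + f a) * x ^ (Fintype.card F - 2))
    {b : F} (hb : b ≠ 0) (x : F) : ∃ y, y ≠ x ∧ f y + f x = b * (y + x) := by
  obtain ⟨u, hu⟩ := (hoval x).2 b
  dsimp only at hu
  have hu0 : u ≠ 0 := by
    rintro rfl
    rw [zero_pow (by omega), mul_zero] at hu
    exact hb hu.symm
  refine ⟨u + x, by simpa using hu0, ?_⟩
  rw [add_assoc, CharTwo.add_self_eq_zero, add_zero, ← hu]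
  linear_combination (-(f (u + x) + f x)) * pow_card_sub_two_mul_self hq.le hu0

/-- The graph of an oval polynomial is an arc. -/
theorem arc_of_oval (hq : 2 ≤ Fintype.card F)
    (hoval : ∀ a : F, Function.Bijective
      fun x : F => (f (x + a) + f a) * x ^ (Fintype.card F - 2))
    {a b c x y z : F} (hp : (a, b, c) ≠ 0) (hxy : y ≠ x) (hxz : z ≠ x)
    (hx : a * f x + b * x + c = 0) (hy : a * f y + b * y + c = 0)
    (hz : a * f z + b * z + c = 0) : y = z := by
  have hxy' : y + x ≠ 0 := fun h => hxy (CharTwo.add_eq_zero.mp h)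
  have h2 : (2 : F) = 0 := CharTwo.two_eq_zero
  have ha : a ≠ 0 := by
    rintro rfl
    have hb : b = 0 := by
      refine (mul_eq_zero.mp ?_).resolve_right hxy'
      linear_combination hx + hy - c * h2
    subst hb
    apply hp
    simpa using hx
  have key : ∀ w, a * f w + b * w + c = 0 → f w + f x = b / a * (w + x) := by
    intro w hw
    field_simp
    linear_combination hw + hx - (b * w + b * x + c) * h2
  exact secant_unique hq hoval hxy hxz (key y hy) (key z hz)

/-- If `f` commutes with squaring and the degree of `F` over `GF(2)` is odd, the line
`f(x) + x = 1` misses the graph of `f`. -/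
theorem apply_add_self_ne_one {m : ℕ} (hmodd : Odd m) (hcard : Fintype.card F = 2 ^ m)
    (hoval : ∀ a : F, Function.Bijective
      fun x : F => (f (x + a) + f a) * x ^ (Fintype.card F - 2))
    (hq : 2 ≤ Fintype.card F) (hf0 : f 0 = 0) (hf1 : f 1 = 1)
    (hfrob : ∀ x : F, f (x ^ 2) = f x ^ 2) (x : F) : f x + x ≠ 1 := by
  intro hx
  have h2 : (2 : F) = 0 := CharTwo.two_eq_zero
  have hsq : ∀ w, f w + w = 1 → f (w ^ 2) + w ^ 2 = 1 := by
    intro w hw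
    rw [hfrob, ← CharTwo.add_sq, hw, one_pow]
  have hne : x ^ 2 ≠ x := by
    intro h
    have : x * (x - 1) = 0 := by linear_combination h
    rcases mul_eq_zero.mp this with h | h
    · simp [h, hf0] at hx
    · rw [sub_eq_zero.mp h, hf1, CharTwo.add_self_eq_zero] at hx
      exact zero_ne_one hx
  have h4 : x ^ 4 = x := by
    by_contra h4
    have hx2 := hsq x hx
    have hx4 := hsq _ hx2
    rw [← pow_mul] at hx4
    have h := arc_of_oval (f := f) (a := 1) (b := 1) (c := 1) hq hoval (by simp) hne h4
      (by linear_combination hx + h2) (by linear_combination hx2 + h2)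
      (by linear_combination hx4 + h2)
    refine hne (sub_eq_zero.mp (pow_eq_zero_iff two_ne_zero |>.mp ?_))
    linear_combination (x ^ 2 - x ^ 3) * h2 - h
  have hpow : ∀ k : ℕ, x ^ 4 ^ k = x := by
    intro k
    induction k with
    | zero => simp
    | succ k ih => rw [pow_succ, pow_mul, ih, h4]
  obtain ⟨k, rfl⟩ := hmodd
  have := FiniteField.pow_card x
  rw [hcard, pow_succ, pow_mul, pow_mul, show (2 : ℕ) ^ 2 = 4 from rfl, hpow] at this
  exact hne this

/-- Some line through `(1, 0)` meets the graph of an oval polynomial in two points with nonzero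
argument. -/
theorem exists_secant_through_one_zero (hq : 2 < Fintype.card F) (hbij : Function.Bijective f)
    (hoval : ∀ a : F, Function.Bijective
      fun x : F => (f (x + a) + f a) * x ^ (Fintype.card F - 2))
    (hf0 : f 0 = 0) (hf1 : f 1 = 1) :
    ∃ b x y : F, x ≠ 0 ∧ y ≠ 0 ∧ y ≠ x ∧ f x = b * x + 1 ∧ f y = b * y + 1 := by
  classical
  obtain ⟨x, hx⟩ : ∃ x, x ∉ ({0, 1} : Finset F) := by
    by_contra! h
    exact hq.not_ge ((Finset.card_le_card fun x _ => h x).trans Finset.card_le_two)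
  obtain ⟨hx0, hx1⟩ : x ≠ 0 ∧ x ≠ 1 := by simpa using hx
  have h2 : (2 : F) = 0 := CharTwo.two_eq_zero
  have hfx : f x + 1 ≠ 0 := fun h => hx1 (hbij.1 ((CharTwo.add_eq_zero.mp h).trans hf1.symm))
  have hbx : f x = (f x + 1) / x * x + 1 := by
    rw [div_mul_cancel₀ _ hx0]
    linear_combination -h2
  obtain ⟨y, hyx, hy⟩ := exists_secant hq hoval (div_ne_zero hfx hx0) x
  generalize (f x + 1) / x = b at hbx hy
  have hby : f y = b * y + 1 := by linear_combination hy - hbx - h2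
  refine ⟨b, x, y, hx0, ?_, hyx, hbx, hby⟩
  rintro rfl
  simp [hf0] at hby

variable [DecidableEq F]

/-- If the line `f(x) + x = 1` misses the graph of an oval polynomial `f`, a nonzero codeword of
`C_f` has at most three zeros. -/
theorem card_sub_two_le_wt (hq : 2 ≤ Fintype.card F)
    (hoval : ∀ a : F, Function.Bijective
      fun x : F => (f (x + a) + f a) * x ^ (Fintype.card F - 2))
    (hline : ∀ x, f x + x ≠ 1) {p : F × F × F} (hp : p ≠ 0) :
    Fintype.card F - 2 ≤ wt (Cword f p) := by
  have htot := (wt_add_card_zeros (Cword f p)).trans card_codeIndex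
  set Z := Finset.univ.filter fun i => Cword f p i = 0
  suffices Z.card ≤ 3 by omega
  obtain ⟨a, b, c⟩ := p
  have hleft : ∀ x, x ∈ Z.toLeft → a * f x.1 + b * x.1 + c = 0 := by
    intro x hx
    exact (Finset.mem_filter.mp (Finset.mem_toLeft.mp hx)).2
  have h2 : Z.toLeft.card ≤ 2 := by
    by_contra! h
    obtain ⟨x, y, z, hx, hy, hz, hxy, hxz, hyz⟩ := Finset.two_lt_card_iff.mp h
    exact hyz (Subtype.ext (arc_of_oval hq hoval hp (Subtype.coe_ne_coe.mpr hxy.symm)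
      (Subtype.coe_ne_coe.mpr hxz.symm) (hleft x hx) (hleft y hy) (hleft z hz)))
  have hcard := Z.card_toLeft_add_card_toRight
  have hright : Z.toRight.card ≤ 2 := Z.toRight.card_le_univ
  by_contra! h4
  have huniv : Z.toRight = Finset.univ :=
    Finset.eq_univ_of_card _ (by rw [Fintype.card_fin]; omega)
  have hb : b + c = 0 := by
    have : (0 : Fin 2) ∈ Z.toRight := huniv ▸ Finset.mem_univ _
    exact (Finset.mem_filter.mp (Finset.mem_toRight.mp this)).2
  have ha : a + c = 0 := by
    have : (1 : Fin 2) ∈ Z.toRight := huniv ▸ Finset.mem_univ _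
    exact (Finset.mem_filter.mp (Finset.mem_toRight.mp this)).2
  obtain rfl := CharTwo.add_eq_zero.mp ha
  obtain rfl := CharTwo.add_eq_zero.mp hb
  have hb0 : b ≠ 0 := by
    rintro rfl
    exact hp rfl
  obtain ⟨x, hx⟩ := Finset.card_pos.mp (show 0 < Z.toLeft.card by omega)
  have hx1 : b * (f x.1 + x.1 + 1) = 0 := by linear_combination hleft x hx
  exact hline x.1 (CharTwo.add_eq_zero.mp ((mul_eq_zero.mp hx1).resolve_left hb0))

/-- A secant through `(1, 0)` yields a codeword with three zeros. -/
theorem wt_Cword_le_of_secant {b x y : F} (hx0 : x ≠ 0) (hy0 : y ≠ 0) (hyx : y ≠ x)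
    (hx : f x = b * x + 1) (hy : f y = b * y + 1) :
    wt (Cword f (1, b, 1)) ≤ Fintype.card F - 2 := by
  have h2 : (2 : F) = 0 := CharTwo.two_eq_zero
  have htot := (wt_add_card_zeros (Cword f (1, b, 1))).trans card_codeIndex
  have hsub : ({.inl ⟨x, hx0⟩, .inl ⟨y, hy0⟩, .inr 1} : Finset ({x : F // x ≠ 0} ⊕ Fin 2)) ⊆
      Finset.univ.filter fun i => Cword f (1, b, 1) i = 0 := by
    intro i hi
    simp only [Finset.mem_insert, Finset.mem_singleton] at hi
    rw [Finset.mem_filter]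
    refine ⟨Finset.mem_univ _, ?_⟩
    rcases hi with rfl | rfl | rfl
    · simp only [Cword, Sum.elim_inl]
      linear_combination hx + (b * x + 1) * h2
    · simp only [Cword, Sum.elim_inl]
      linear_combination hy + (b * y + 1) * h2
    · simpa [Cword] using CharTwo.add_self_eq_zero (1 : F)
  have hthree : ({.inl ⟨x, hx0⟩, .inl ⟨y, hy0⟩, .inr 1} :
      Finset ({x : F // x ≠ 0} ⊕ Fin 2)).card = 3 :=
    Finset.card_eq_three.mpr ⟨_, _, _, by simpa using hyx.symm, by simp, by simp, rfl⟩
  have := Finset.card_le_card hsub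
  omega

/-- A secant through `(1, 0)` yields a dual codeword of weight three. -/
theorem exists_dual_wt_three_of_secant {b x y : F} (hx0 : x ≠ 0) (hy0 : y ≠ 0) (hyx : y ≠ x)
    (hx : f x = b * x + 1) (hy : f y = b * y + 1) :
    ∃ v : {x : F // x ≠ 0} ⊕ Fin 2 → F,
      (∀ p : F × F × F, ∑ i, v i * Cword f p i = 0) ∧ v ≠ 0 ∧ wt v = 3 := by
  have h2 : (2 : F) = 0 := CharTwo.two_eq_zero
  have hxy : x + y ≠ 0 := fun h => hyx (CharTwo.add_eq_zero.mp h).symm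
  let i : {x : F // x ≠ 0} ⊕ Fin 2 := .inl ⟨x, hx0⟩
  let j : {x : F // x ≠ 0} ⊕ Fin 2 := .inl ⟨y, hy0⟩
  let k : {x : F // x ≠ 0} ⊕ Fin 2 := .inr 1
  have hij : i ≠ j := by simpa [i, j] using hyx.symm
  have hik : i ≠ k := by simp [i, k]
  have hjk : j ≠ k := by simp [j, k]
  let v : {x : F // x ≠ 0} ⊕ Fin 2 → F := Pi.single i y + Pi.single j x + Pi.single k (x + y)
  have hvi : v i = y := by simp [v, hij, hik]
  have hvj : v j = x := by simp [v, hij.symm, hjk]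
  have hvk : v k = x + y := by simp [v, hik.symm, hjk.symm]
  refine ⟨v, fun p => ?_, fun h => hy0 (by rw [← hvi, h, Pi.zero_apply]), ?_⟩
  · simp only [v, Pi.add_apply, add_mul, Finset.sum_add_distrib, Pi.single_apply, ite_mul,
      zero_mul, Finset.sum_ite_eq', Finset.mem_univ, if_true]
    simp only [i, j, k, Cword, Sum.elim_inl, Sum.elim_inr, Matrix.cons_val_one,
      Matrix.cons_val_fin_one, hx, hy]
    linear_combination (p.1 * (b * x * y + x + y) + p.2.1 * x * y + p.2.2 * (x + y)) * h2
  · refine Finset.card_eq_three.mpr ⟨i, j, k, hij, hik, hjk, ?_⟩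
    ext l
    simp only [Finset.mem_filter, Finset.mem_univ, true_and, Finset.mem_insert,
      Finset.mem_singleton]
    constructor
    · intro hl
      by_contra! h
      exact hl (by simp [v, h.1, h.2.1, h.2.2])
    · rintro (rfl | rfl | rfl)
      · rwa [hvi]
      · rwa [hvj]
      · rwa [hvk]

end

/-- **Theorem (Theorem `thm-nmdscodej231`).**  Let `m ≥ 3` be odd, `q = 2^m`,
`F = GF(q)` and let `f` be an oval polynomial over `F` with `f(x²) = f(x)²`
for all `x`.  Then `C_f` is an NMDS code with parameters `[q+1, 3, q-2]`: the
minimum Hamming weight of a nonzero codeword of `C_f` is `q-2`, and the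
minimum Hamming weight of a nonzero codeword of the dual code `C_f^⊥` is `3`. -/
theorem stmt_11 (m : ℕ) (hm : 3 ≤ m) (hmodd : Odd m)
    (F : Type) [Field F] [Fintype F] [DecidableEq F] (hcard : Fintype.card F = 2 ^ m)
    (f : F → F)
    (hbij : Function.Bijective f) (hf0 : f 0 = 0) (hf1 : f 1 = 1)
    (hoval : ∀ a : F, Function.Bijective fun x : F => (f (x + a) + f a) * x ^ (2 ^ m - 2))
    (hfrob : ∀ x : F, f (x ^ 2) = f x ^ 2) :
    (∀ v : {x : F // x ≠ 0} ⊕ Fin 2 → F, (∃ p : F × F × F, v = Cword f p) →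
        v ≠ 0 → 2 ^ m - 2 ≤ wt v)
    ∧ (∃ v : {x : F // x ≠ 0} ⊕ Fin 2 → F, (∃ p : F × F × F, v = Cword f p) ∧
        v ≠ 0 ∧ wt v = 2 ^ m - 2)
    ∧ (∀ v : {x : F // x ≠ 0} ⊕ Fin 2 → F,
        (∀ p : F × F × F, ∑ i, v i * Cword f p i = 0) → v ≠ 0 → 3 ≤ wt v)
    ∧ (∃ v : {x : F // x ≠ 0} ⊕ Fin 2 → F,
        (∀ p : F × F × F, ∑ i, v i * Cword f p i = 0) ∧ v ≠ 0 ∧ wt v = 3) := by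
  have h2 : (2 : F) = 0 := by
    have h := FiniteField.cast_card_eq_zero F
    rw [hcard, Nat.cast_pow, Nat.cast_ofNat] at h
    exact pow_eq_zero_iff (by omega) |>.mp h
  have : CharP F 2 := CharTwo.of_one_ne_zero_of_two_eq_zero one_ne_zero h2
  have hq : 2 < Fintype.card F := by
    rw [hcard]
    exact lt_of_lt_of_le (by norm_num) (Nat.pow_le_pow_right two_pos hm)
  rw [← hcard] at hoval ⊢
  have hmin : ∀ p : F × F × F, p ≠ 0 → Fintype.card F - 2 ≤ wt (Cword f p) := fun p =>
    card_sub_two_le_wt hq.le hoval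
      (apply_add_self_ne_one hmodd hcard hoval hq.le hf0 hf1 hfrob)
  obtain ⟨b, x, y, hx0, hy0, hyx, hx, hy⟩ :=
    exists_secant_through_one_zero hq hbij hoval hf0 hf1
  have hwt : wt (Cword f (1, b, 1)) = Fintype.card F - 2 :=
    le_antisymm (wt_Cword_le_of_secant hx0 hy0 hyx hx hy) (hmin _ (by simp))
  refine ⟨?_, ⟨_, ⟨_, rfl⟩, ?_, hwt⟩, fun v => three_le_wt_of_dual hf1,
    exists_dual_wt_three_of_secant hx0 hy0 hyx hx hy⟩
  · rintro v ⟨p, rfl⟩ hv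
    refine hmin p ?_
    rintro rfl
    refine hv (funext fun i => ?_)
    simp [Cword_apply]
  · intro h
    rw [h] at hwt
    simp [wt] at hwt
    omega
end

section
/- Let m ≥ 3 be odd, q = 2^m, F = GF(q), and let f : F → F be an oval polynomial such that f(x^2) = f(x)^2 for all x ∈ F. Then the number of 2-element subsets {x, y} of F \ {0, 1} such that (f(x)+1)·y + (f(y)+1)·x = 0 is exactly (q-2)/2. -/
/-- If `R` is a symmetric relation assigning to each point of `S` a unique partner in `S`,
different from it, then the related pairs partition `S`. -/
theorem two_mul_card_pairs_of_existsUnique {α : Type*} [Fintype α] [DecidableEq α]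
    (S : Finset α) (R : α → α → Prop) (hsymm : ∀ x y, R x y → R y x)
    (h : ∀ a ∈ S, ∃! y, y ∈ S ∧ a ≠ y ∧ R a y) :
    2 * Nat.card {s : Finset α // s.card = 2 ∧ (∀ x ∈ s, x ∈ S) ∧
      ∃ x ∈ s, ∃ y ∈ s, x ≠ y ∧ R x y} = S.card := by
  classical
  rw [Nat.card_eq_fintype_card, Fintype.card_subtype]
  set T : Finset (Finset α) := Finset.univ.filter fun s => s.card = 2 ∧ (∀ x ∈ s, x ∈ S) ∧
    ∃ x ∈ s, ∃ y ∈ s, x ≠ y ∧ R x y with hT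
  have hpair : ∀ s ∈ T, ∀ a ∈ s, ∃ b ∈ S, a ≠ b ∧ R a b ∧ s = {a, b} := by
    intro s hs a ha
    obtain ⟨hcard, hsub, x, hx, y, hy, hxy, hR⟩ := (Finset.mem_filter.1 hs).2
    have hs' : s = {x, y} := by
      symm
      apply Finset.eq_of_subset_of_card_le
      · simp [Finset.insert_subset_iff, hx, hy]
      · rw [hcard, Finset.card_pair hxy]
    rw [hs', Finset.mem_insert, Finset.mem_singleton] at ha
    rcases ha with rfl | rfl
    · exact ⟨y, hsub y hy, hxy, hR, hs'⟩
    · exact ⟨x, hsub x hx, hxy.symm, hsymm _ _ hR, by rw [hs', Finset.pair_comm]⟩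
  have hone : ∀ a ∈ S, (T.filter fun s => a ∈ s).card = 1 := by
    intro a ha
    obtain ⟨y, ⟨hyS, hay, hR⟩, huniq⟩ := h a ha
    rw [Finset.card_eq_one]
    refine ⟨{a, y}, ?_⟩
    ext s
    rw [Finset.mem_filter, Finset.mem_singleton]
    constructor
    · rintro ⟨hs, has⟩
      obtain ⟨b, hbS, hab, hRb, rfl⟩ := hpair s hs a has
      rw [huniq b ⟨hbS, hab, hRb⟩]
    · rintro rfl
      refine ⟨Finset.mem_filter.2 ⟨Finset.mem_univ _, Finset.card_pair hay, ?_, a, ?_, y, ?_,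
        hay, hR⟩, ?_⟩ <;> simp [ha, hyS]
  have hsum := Finset.sum_card_inter hone
  have hinter : ∀ s ∈ T, (S ∩ s).card = 2 := by
    intro s hs
    obtain ⟨hcard, hsub, -⟩ := (Finset.mem_filter.1 hs).2
    rw [Finset.inter_eq_right.2 hsub, hcard]
  rw [Finset.sum_congr rfl hinter, Finset.sum_const, smul_eq_mul] at hsum
  omega

/-- Each line with nonzero slope through a point of the graph of an oval polynomial meets the
graph in exactly one further point. -/
theorem existsUnique_secant {F : Type*} [Field F] [CharP F 2] {f : F → F} {a : F}
    {n : ℕ} (hn : n ≠ 0) (hinv : ∀ x : F, x ≠ 0 → x ^ n = x⁻¹)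
    (hoval : Function.Bijective fun x : F => (f (x + a) + f a) * x ^ n)
    {c : F} (hc : c ≠ 0) :
    ∃! y, a ≠ y ∧ f y + f a = c * (y + a) := by
  obtain ⟨x, hx, huniq⟩ := hoval.existsUnique c
  have hx0 : x ≠ 0 := by
    rintro rfl
    simp [hn] at hx
    exact hc hx.symm
  simp only [hinv x hx0] at hx
  refine ⟨x + a, ⟨by simpa using hx0, ?_⟩, ?_⟩
  · rw [add_assoc, CharTwo.add_self_eq_zero, add_zero, ← hx]
    field_simp
  · rintro y ⟨hay, hy⟩
    have hya : y + a ≠ 0 := fun h => hay (CharTwo.add_eq_zero.1 h).symm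
    have hyx : y + a = x := by
      apply huniq
      simp only [hinv _ hya]
      rw [add_assoc, CharTwo.add_self_eq_zero, add_zero, hy]
      field_simp
    rw [← hyx, add_assoc, CharTwo.add_self_eq_zero, add_zero]

/-- **Theorem.**  Let `m ≥ 3` be odd, `q = 2^m`, `F = GF(q)` and let `f` be an
oval polynomial over `F` with `f(x²) = f(x)²` for all `x`.  Then the number of
2-element subsets `{x, y}` of `F \ {0, 1}` with `(f(x)+1)·y + (f(y)+1)·x = 0`
is exactly `(q-2)/2`. -/
theorem stmt_13 (m : ℕ) (hm : 3 ≤ m) (hmodd : Odd m)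
    (F : Type) [Field F] [Fintype F] [DecidableEq F] (hcard : Fintype.card F = 2 ^ m)
    (f : F → F)
    (hbij : Function.Bijective f) (hf0 : f 0 = 0) (hf1 : f 1 = 1)
    (hoval : ∀ a : F, Function.Bijective fun x : F => (f (x + a) + f a) * x ^ (2 ^ m - 2))
    (hfrob : ∀ x : F, f (x ^ 2) = f x ^ 2) :
    2 * Nat.card {s : Finset F // s.card = 2 ∧ (∀ x ∈ s, x ≠ 0 ∧ x ≠ 1) ∧
        ∃ x ∈ s, ∃ y ∈ s, x ≠ y ∧ (f x + 1) * y + (f y + 1) * x = 0}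
      = 2 ^ m - 2 := by
  have : CharP F 2 := charP_of_card_eq_prime_pow hcard
  have hq : 2 ^ 3 ≤ 2 ^ m := Nat.pow_le_pow_right (by norm_num) hm
  have hinv : ∀ x : F, x ≠ 0 → x ^ (2 ^ m - 2) = x⁻¹ := by
    intro x hx
    apply eq_inv_of_mul_eq_one_left
    rw [← pow_succ, show 2 ^ m - 2 + 1 = Fintype.card F - 1 by omega]
    exact FiniteField.pow_card_sub_one_eq_one x hx
  have key := two_mul_card_pairs_of_existsUnique (Finset.univ \ {0, 1} : Finset F)
    (fun x y => (f x + 1) * y + (f y + 1) * x = 0)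
    (fun x y h => by rw [add_comm]; exact h) ?_
  · rw [Finset.card_sdiff_of_subset (Finset.subset_univ _), Finset.card_univ, hcard,
      Finset.card_pair zero_ne_one] at key
    simpa using key
  · intro a ha
    have ha' : a ≠ 0 ∧ a ≠ 1 := by simpa using ha
    obtain ⟨ha0, ha1⟩ := ha'
    have hfa : f a + 1 ≠ 0 := fun h =>
      ha1 (hbij.injective ((CharTwo.add_eq_zero.1 h).trans hf1.symm))
    obtain ⟨c, hc⟩ : ∃ c, f a + 1 = c * a := ⟨(f a + 1) / a, by field_simp⟩
    have hc0 : c ≠ 0 := by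
      rintro rfl
      exact hfa (by rw [hc, zero_mul])
    have h2 : (2 : F) = 0 := CharTwo.two_eq_zero
    refine (existsUnique_congr fun y => ?_).1
      (existsUnique_secant (by omega) hinv (hoval a) hc0)
    constructor
    · rintro ⟨hay, hy⟩
      have hy1 : f y + 1 = c * y := by linear_combination hy + hc + (c * a - f a) * h2
      refine ⟨?_, hay, ?_⟩
      · have hy0 : y ≠ 0 := by
          rintro rfl
          simp [hf0] at hy1
        have hy2 : y ≠ 1 := by
          rintro rfl
          rw [hf1, CharTwo.add_self_eq_zero, mul_one] at hy1
          exact hc0 hy1.symm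
        simp [hy0, hy2]
      · rw [hc, hy1]
        linear_combination c * a * y * h2
    · rintro ⟨-, hay, hR⟩
      refine ⟨hay, ?_⟩
      have hy1 : f y + 1 = c * y := by
        apply mul_right_cancel₀ ha0
        linear_combination hR - y * hc - c * a * y * h2
      linear_combination hy1 + hc - h2
end
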